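/- Let f ∈ PL([0,1]) with corner set C_f = {c_1, …, c_d}, and set v_j = log|Df_+(c_j)| − log|Df_−(c_j)|. Let 𝓘 = {I_0, …, I_{q−1}} be a cycle of f such that C_f is contained in the interior of ∪𝓘 and each interval of 𝓘 contains at most one corner point; say c_j ∈ I_{k_j}. Set B = Σ_{y ∈ ∂(∪𝓘)} log|Df(y)| (f is differentiable at each endpoint y of an interval of 𝓘). Let x ∈ I_0 satisfy f^i(x) ∉ C_f for all 0 ≤ i < q, and define σ_j = +1 if f^{k_j}(x) > c_j and σ_j = −1 if f^{k_j}(x) < c_j. Then 2·log|Df^q(x)| = B + Σ_{j=1}^{d} σ_j·v_j. -/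

import Mathlib

/-- `f` is a piecewise affine map of `[0,1]` into itself: continuous, and affine with
nonzero slope on each interval of some finite partition `0 = a 0 < a 1 < ⋯ < a d = 1`. -/
def IsPLMap (f : ℝ → ℝ) : Prop :=
  ContinuousOn f (Set.Icc 0 1) ∧ Set.MapsTo f (Set.Icc 0 1) (Set.Icc 0 1) ∧
    ∃ (d : ℕ) (a s c : ℕ → ℝ), 1 ≤ d ∧ a 0 = 0 ∧ a d = 1 ∧
      (∀ i < d, a i < a (i + 1)) ∧ (∀ i < d, s i ≠ 0) ∧
      (∀ i < d, ∀ x ∈ Set.Icc (a i) (a (i + 1)), f x = s i * x + c i)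

/-- The set of corner points of `f`: interior points of `[0,1]` where the two
one-sided derivatives (slopes) of `f` differ. -/
def cornerSet (f : ℝ → ℝ) : Set ℝ :=
  {x | x ∈ Set.Ioo (0 : ℝ) 1 ∧
    derivWithin f (Set.Ici x) x ≠ derivWithin f (Set.Iic x) x}

/-- `V = Var(log |Df|)`, the total variation of `log |Df|` over `[0,1]`, i.e. the sum
over the corner points of `f` of the jumps of `log |Df|` there. -/
noncomputable def logSlopeVar (f : ℝ → ℝ) : ℝ :=
  ∑ᶠ x ∈ cornerSet f,
    |Real.log (|derivWithin f (Set.Ici x) x|) - Real.log (|derivWithin f (Set.Iic x) x|)|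

/-- `I 0, …, I (q-1)` is a cycle of `f`: pairwise disjoint nondegenerate closed
subintervals of `[0,1]` mapped cyclically into one another by `f`. -/
def IsCycle (f : ℝ → ℝ) (q : ℕ) (I : ℕ → Set ℝ) : Prop :=
  1 ≤ q ∧ (∀ j < q, ∃ u v : ℝ, u < v ∧ I j = Set.Icc u v) ∧
    (∀ j < q, I j ⊆ Set.Icc 0 1) ∧
    (∀ i < q, ∀ j < q, i ≠ j → Disjoint (I i) (I j)) ∧
    (∀ j < q, f '' I j ⊆ I ((j + 1) % q))

/-- The union `∪𝓘` of the intervals of a cycle. -/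
def cycleUnion (q : ℕ) (I : ℕ → Set ℝ) : Set ℝ := ⋃ j < q, I j

/-- `𝓘¹ ⊃ 𝓘²`, the cycles are nested: every interval of the cycle `𝓘²` is contained in
some interval of the cycle `𝓘¹`, and the two collections of intervals are different. -/
def CycleNested (q₁ : ℕ) (I1 : ℕ → Set ℝ) (q₂ : ℕ) (I2 : ℕ → Set ℝ) : Prop :=
  (∀ j < q₂, ∃ i < q₁, I2 j ⊆ I1 i) ∧ I2 '' Set.Iio q₂ ≠ I1 '' Set.Iio q₁

/-- `G` is a gap of the cycle `I2`, with left neighbour `I2 l` and right neighbour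
`I2 r`: an open interval disjoint from `∪𝓘²` lying strictly between the two adjacent
intervals `I2 l` and `I2 r` (whose closures it meets). -/
def IsGap (q₂ : ℕ) (I2 : ℕ → Set ℝ) (l r : ℕ) (G : Set ℝ) : Prop :=
  l < q₂ ∧ r < q₂ ∧
    ∃ a b : ℝ, a < b ∧ G = Set.Ioo a b ∧
      a ∈ I2 l ∧ (∀ y ∈ I2 l, y ≤ a) ∧ b ∈ I2 r ∧ (∀ y ∈ I2 r, b ≤ y) ∧
      ∀ j < q₂, Disjoint G (I2 j)

/-- `P` is a splitting for the nested pair of cycles `𝓘¹ ⊃ 𝓘²`: a finite union of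
periodic orbits of `f` such that every point of `P` lies in a gap and every gap
contains exactly one point of `P`. -/
def IsSplitting (f : ℝ → ℝ) (q₁ : ℕ) (I1 : ℕ → Set ℝ) (q₂ : ℕ) (I2 : ℕ → Set ℝ)
    (P : Set ℝ) : Prop :=
  P.Finite ∧ Set.MapsTo f P P ∧ (∀ x ∈ P, ∃ p, 1 ≤ p ∧ f^[p] x = x) ∧
    (∀ x ∈ P, ∃ i < q₁, ∃ l r G, IsGap q₂ I2 l r G ∧ G ⊆ I1 i ∧ x ∈ G) ∧
    (∀ i < q₁, ∀ l r G, IsGap q₂ I2 l r G → G ⊆ I1 i → ∃! x, x ∈ P ∩ G)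

/-- The cycle `I2` (with `q₂` intervals) is a doubling of the cycle `I` (with `q`
intervals): `I` is a cycle, `𝓘 ⊃ 𝓘²`, and `q₂ = 2q`. -/
def IsDoublingOf (f : ℝ → ℝ) (q₂ : ℕ) (I2 : ℕ → Set ℝ) (q : ℕ) (I : ℕ → Set ℝ) : Prop :=
  IsCycle f q I ∧ CycleNested q I q₂ I2 ∧ q₂ = 2 * q

/-- `x` is a periodic point of `f` of minimal period `p`. -/
def MinimalPeriod (f : ℝ → ℝ) (x : ℝ) (p : ℕ) : Prop :=
  1 ≤ p ∧ f^[p] x = x ∧ ∀ k, 1 ≤ k → k < p → f^[k] x ≠ x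

open Set Filter Topology

namespace IsPLMap

variable {f : ℝ → ℝ}

/-- To the right of every point of `[0,1)` a piecewise affine map is affine. -/
theorem exists_affine_right (hf : IsPLMap f) {y : ℝ} (h0 : 0 ≤ y) (h1 : y < 1) :
    ∃ s b c : ℝ, s ≠ 0 ∧ y < b ∧ EqOn f (fun t => s * t + c) (Icc y b) := by
  classical
  obtain ⟨-, -, d, a, s, c, -, ha0, had, -, hs, haff⟩ := hf
  have hex : ∃ n, y < a n := ⟨d, by rwa [had]⟩
  obtain ⟨n, hn⟩ : ∃ n, Nat.find hex = n + 1 := by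
    refine Nat.exists_eq_succ_of_ne_zero fun h => ?_
    have := Nat.find_spec hex
    rw [h, ha0] at this
    linarith
  have hy : y < a (n + 1) := hn ▸ Nat.find_spec hex
  have hy' : a n ≤ y := not_lt.1 (Nat.find_min hex (by omega))
  have hnd : n < d := by
    have : Nat.find hex ≤ d := Nat.find_le (by rwa [had])
    omega
  exact ⟨s n, a (n + 1), c n, hs n hnd, hy, fun t ht => haff n hnd t ⟨hy'.trans ht.1, ht.2⟩⟩

/-- To the left of every point of `(0,1]` a piecewise affine map is affine. -/
theorem exists_affine_left (hf : IsPLMap f) {y : ℝ} (h0 : 0 < y) (h1 : y ≤ 1) :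
    ∃ s b c : ℝ, s ≠ 0 ∧ b < y ∧ EqOn f (fun t => s * t + c) (Icc b y) := by
  classical
  obtain ⟨-, -, d, a, s, c, -, ha0, had, -, hs, haff⟩ := hf
  have hex : ∃ n, y ≤ a n := ⟨d, by rwa [had]⟩
  obtain ⟨n, hn⟩ : ∃ n, Nat.find hex = n + 1 := by
    refine Nat.exists_eq_succ_of_ne_zero fun h => ?_
    have := Nat.find_spec hex
    rw [h, ha0] at this
    linarith
  have hy : y ≤ a (n + 1) := hn ▸ Nat.find_spec hex
  have hy' : a n < y := not_le.1 (Nat.find_min hex (by omega))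
  have hnd : n < d := by
    have : Nat.find hex ≤ d := Nat.find_le (by rwa [had])
    omega
  exact ⟨s n, a n, c n, hs n hnd, hy', fun t ht => haff n hnd t ⟨ht.1, ht.2.trans hy⟩⟩

end IsPLMap

section AffineDerivatives

variable {f : ℝ → ℝ} {s c a b : ℝ}

theorem hasDerivAt_of_eqOn_affine (h : EqOn f (fun t => s * t + c) (Icc a b)) {t : ℝ}
    (ht : t ∈ Ioo a b) : HasDerivAt f s t := by
  have h1 : HasDerivAt (fun t => s * t + c) s t := by
    simpa using ((hasDerivAt_id t).const_mul s).add_const c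
  exact h1.congr_of_eventuallyEq (h.eventuallyEq_of_mem (Icc_mem_nhds ht.1 ht.2))

theorem hasDerivWithinAt_Ici_of_eqOn_affine (h : EqOn f (fun t => s * t + c) (Icc a b))
    (hab : a < b) : HasDerivWithinAt f s (Ici a) a := by
  have h1 : HasDerivAt (fun t => s * t + c) s a := by
    simpa using ((hasDerivAt_id a).const_mul s).add_const c
  exact h1.hasDerivWithinAt.congr_of_eventuallyEq
    (h.eventuallyEq_of_mem (Icc_mem_nhdsGE hab)) (h ⟨le_rfl, hab.le⟩)

theorem hasDerivWithinAt_Iic_of_eqOn_affine (h : EqOn f (fun t => s * t + c) (Icc a b))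
    (hab : a < b) : HasDerivWithinAt f s (Iic b) b := by
  have h1 : HasDerivAt (fun t => s * t + c) s b := by
    simpa using ((hasDerivAt_id b).const_mul s).add_const c
  exact h1.hasDerivWithinAt.congr_of_eventuallyEq
    (h.eventuallyEq_of_mem (Icc_mem_nhdsLE hab)) (h ⟨hab.le, le_rfl⟩)

end AffineDerivatives

theorem derivWithin_Ici_eq_Iic_of_notMem_cornerSet {f : ℝ → ℝ} {y : ℝ} (hy : y ∈ Ioo (0 : ℝ) 1)
    (hC : y ∉ cornerSet f) : derivWithin f (Ici y) y = derivWithin f (Iic y) y :=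
  not_not.1 fun h => hC ⟨hy, h⟩

namespace IsPLMap

variable {f : ℝ → ℝ}

/-- Off the corner set, the right slope is the derivative within `[0,1]`. -/
theorem hasDerivWithinAt_of_Ici (hf : IsPLMap f) {y m : ℝ} (hy : y ∈ Ico (0 : ℝ) 1)
    (hC : y ∉ cornerSet f) (hm : HasDerivWithinAt f m (Ici y) y) :
    HasDerivWithinAt f m (Icc 0 1) y := by
  rcases hy.1.eq_or_lt with rfl | h0
  · exact hm.mono fun t ht => ht.1
  · obtain ⟨s, b, e, -, hb, he⟩ := hf.exists_affine_left h0 hy.2.le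
    have hl := hasDerivWithinAt_Iic_of_eqOn_affine he hb
    have hms : m = s := by
      rw [← hm.derivWithin (uniqueDiffWithinAt_Ici y), ← hl.derivWithin (uniqueDiffWithinAt_Iic y)]
      exact derivWithin_Ici_eq_Iic_of_notMem_cornerSet ⟨h0, hy.2⟩ hC
    subst hms
    exact (hm.union hl).mono fun t _ => (le_total y t).imp id id

/-- Off the corner set, the left slope is the derivative within `[0,1]`. -/
theorem hasDerivWithinAt_of_Iic (hf : IsPLMap f) {y m : ℝ} (hy : y ∈ Ioc (0 : ℝ) 1)
    (hC : y ∉ cornerSet f) (hm : HasDerivWithinAt f m (Iic y) y) :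
    HasDerivWithinAt f m (Icc 0 1) y := by
  rcases hy.2.eq_or_lt with rfl | h1
  · exact hm.mono fun t ht => ht.2
  · obtain ⟨s, b, e, -, hb, he⟩ := hf.exists_affine_right hy.1.le h1
    have hr := hasDerivWithinAt_Ici_of_eqOn_affine he hb
    have hms : m = s := by
      rw [← hm.derivWithin (uniqueDiffWithinAt_Iic y), ← hr.derivWithin (uniqueDiffWithinAt_Ici y)]
      exact (derivWithin_Ici_eq_Iic_of_notMem_cornerSet ⟨hy.1, h1⟩ hC).symm
    subst hms
    exact (hr.union hm).mono fun t _ => (le_total y t).imp id id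

/-- Near an interior point which is not a corner, the derivative exists and is constant. -/
theorem exists_eventually_hasDerivAt (hf : IsPLMap f) {y : ℝ} (hy : y ∈ Ioo (0 : ℝ) 1)
    (hC : y ∉ cornerSet f) : ∃ m, ∀ᶠ t in 𝓝 y, HasDerivAt f m t := by
  obtain ⟨m, b, e, -, hb, he⟩ := hf.exists_affine_right hy.1.le hy.2
  obtain ⟨s, b', e', -, hb', he'⟩ := hf.exists_affine_left hy.1 hy.2.le
  have hr := hasDerivWithinAt_Ici_of_eqOn_affine he hb
  have hl := hasDerivWithinAt_Iic_of_eqOn_affine he' hb'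
  have hms : m = s := by
    rw [← hr.derivWithin (uniqueDiffWithinAt_Ici y), ← hl.derivWithin (uniqueDiffWithinAt_Iic y)]
    exact derivWithin_Ici_eq_Iic_of_notMem_cornerSet hy hC
  subst hms
  have hee : e = e' := by
    have h1 := he ⟨le_rfl, hb.le⟩
    have h2 := he' ⟨hb'.le, le_rfl⟩
    simp only at h1 h2
    linarith
  subst hee
  have hE : EqOn f (fun t => m * t + e) (Icc b' b) := fun t ht =>
    (le_total y t).elim (fun h => he ⟨h, ht.2⟩) (fun h => he' ⟨ht.1, h⟩)
  exact ⟨m, mem_of_superset (Ioo_mem_nhds hb' hb) fun t ht => hasDerivAt_of_eqOn_affine hE ht⟩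

/-- On an interval whose interior contains no corner, the slope is constant. -/
theorem exists_slope (hf : IsPLMap f) {u v : ℝ} (h0 : 0 ≤ u) (huv : u < v) (h1 : v ≤ 1)
    (hC : ∀ t ∈ Ioo u v, t ∉ cornerSet f) :
    ∃ m, m ≠ 0 ∧ HasDerivWithinAt f m (Ici u) u ∧ HasDerivWithinAt f m (Iic v) v ∧
      ∀ y ∈ Icc u v, y ∉ cornerSet f → HasDerivWithinAt f m (Icc 0 1) y := by
  have hsub : ∀ t ∈ Ioo u v, t ∈ Ioo (0 : ℝ) 1 := fun t ht =>
    ⟨h0.trans_lt ht.1, ht.2.trans_le h1⟩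
  have hloc : ∀ t ∈ Ioo u v, HasDerivAt f (deriv f t) t ∧ HasDerivAt (deriv f) 0 t := by
    intro t ht
    obtain ⟨m, hm⟩ := hf.exists_eventually_hasDerivAt (hsub t ht) (hC t ht)
    refine ⟨hm.self_of_nhds.differentiableAt.hasDerivAt, ?_⟩
    exact (hasDerivAt_const t m).congr_of_eventuallyEq (hm.mono fun z hz => hz.deriv)
  have hconst : ∀ t ∈ Ioo u v, ∀ z ∈ Ioo u v, deriv f t = deriv f z := fun t ht z hz =>
    isOpen_Ioo.is_const_of_deriv_eq_zero isPreconnected_Ioo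
      (fun w hw => (hloc w hw).2.differentiableAt.differentiableWithinAt)
      (fun w hw => (hloc w hw).2.deriv) ht hz
  obtain ⟨m, b, e, hm0, hb, he⟩ := hf.exists_affine_right h0 (huv.trans_le h1)
  obtain ⟨s, b', e', -, hb', he'⟩ := hf.exists_affine_left (h0.trans_lt huv) h1
  obtain ⟨p, hp, hp'⟩ := exists_between (lt_min hb huv)
  obtain ⟨r, hr, hr'⟩ := exists_between (max_lt hb' huv)
  have hpI : p ∈ Ioo u v := ⟨hp, hp'.trans_le (min_le_right _ _)⟩
  have hrI : r ∈ Ioo u v := ⟨(le_max_right _ _).trans_lt hr, hr'⟩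
  have hpm : deriv f p = m :=
    (hasDerivAt_of_eqOn_affine he ⟨hp, hp'.trans_le (min_le_left _ _)⟩).deriv
  have hrs : deriv f r = s :=
    (hasDerivAt_of_eqOn_affine he' ⟨(le_max_left _ _).trans_lt hr, hr'⟩).deriv
  have hms : m = s := by rw [← hpm, ← hrs]; exact hconst p hpI r hrI
  subst hms
  have hR := hasDerivWithinAt_Ici_of_eqOn_affine he hb
  have hL := hasDerivWithinAt_Iic_of_eqOn_affine he' hb'
  refine ⟨m, hm0, hR, hL, fun y hy hyC => ?_⟩
  rcases hy.1.eq_or_lt with rfl | hu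
  · exact hf.hasDerivWithinAt_of_Ici ⟨h0, huv.trans_le h1⟩ hyC hR
  rcases hy.2.eq_or_lt with rfl | hv
  · exact hf.hasDerivWithinAt_of_Iic ⟨h0.trans_lt huv, h1⟩ hyC hL
  have := (hloc y ⟨hu, hv⟩).1
  rw [hconst y ⟨hu, hv⟩ p hpI, hpm] at this
  exact this.hasDerivWithinAt

/-- `f` is differentiable within `[0,1]`, with nonzero slope, off the corner set. -/
theorem exists_hasDerivWithinAt (hf : IsPLMap f) {y : ℝ} (hy : y ∈ Icc (0 : ℝ) 1)
    (hC : y ∉ cornerSet f) : ∃ m, m ≠ 0 ∧ HasDerivWithinAt f m (Icc 0 1) y := by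
  rcases hy.2.eq_or_lt with rfl | h1
  · obtain ⟨m, b, e, hm, hb, he⟩ := hf.exists_affine_left one_pos le_rfl
    exact ⟨m, hm, hf.hasDerivWithinAt_of_Iic ⟨one_pos, le_rfl⟩ hC
      (hasDerivWithinAt_Iic_of_eqOn_affine he hb)⟩
  · obtain ⟨m, b, e, hm, hb, he⟩ := hf.exists_affine_right hy.1 h1
    exact ⟨m, hm, hf.hasDerivWithinAt_of_Ici ⟨hy.1, h1⟩ hC
      (hasDerivWithinAt_Ici_of_eqOn_affine he hb)⟩

/-- Chain rule for the logarithm of the derivative along an orbit avoiding the corners. -/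
theorem log_abs_derivWithin_iterate (hf : IsPLMap f) {x : ℝ} (hx : x ∈ Icc (0 : ℝ) 1) (n : ℕ)
    (hreg : ∀ i < n, f^[i] x ∉ cornerSet f) :
    Real.log |derivWithin (f^[n]) (Icc 0 1) x| =
      ∑ i ∈ Finset.range n, Real.log |derivWithin f (Icc 0 1) (f^[i] x)| := by
  have hU := uniqueDiffOn_Icc_zero_one
  have hmaps : ∀ i, MapsTo (f^[i]) (Icc 0 1) (Icc 0 1) := fun i => hf.2.1.iterate i
  suffices ∃ m, m ≠ 0 ∧ HasDerivWithinAt (f^[n]) m (Icc 0 1) x ∧ Real.log |m| =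
      ∑ i ∈ Finset.range n, Real.log |derivWithin f (Icc 0 1) (f^[i] x)| by
    obtain ⟨m, -, hm, h⟩ := this
    rw [hm.derivWithin (hU x hx), h]
  induction n with
  | zero => exact ⟨1, one_ne_zero, hasDerivWithinAt_id x _, by simp⟩
  | succ n ih =>
    obtain ⟨m, hm0, hm, h⟩ := ih fun i hi => hreg i (by omega)
    obtain ⟨s, hs0, hs⟩ := hf.exists_hasDerivWithinAt (hmaps n hx) (hreg n (by omega))
    refine ⟨s * m, mul_ne_zero hs0 hm0, ?_, ?_⟩
    · rw [Function.iterate_succ']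
      exact hs.comp x hm (hmaps n)
    · rw [Finset.sum_range_succ, ← h, hs.derivWithin (hU _ (hmaps n hx)), abs_mul,
        Real.log_mul (abs_ne_zero.2 hs0) (abs_ne_zero.2 hm0), add_comm]

/-- On an interval without corners the logarithmic slope is the average of those at the
endpoints. -/
theorem two_log_eq_of_no_corner (hf : IsPLMap f) {u v y : ℝ} (h0 : 0 ≤ u) (huv : u < v)
    (h1 : v ≤ 1) (hC : ∀ t ∈ Icc u v, t ∉ cornerSet f) (hy : y ∈ Icc u v) :
    2 * Real.log |derivWithin f (Icc 0 1) y| =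
      Real.log |derivWithin f (Icc 0 1) u| + Real.log |derivWithin f (Icc 0 1) v| := by
  obtain ⟨m, -, -, -, hm⟩ := hf.exists_slope h0 huv h1 fun t ht => hC t (Ioo_subset_Icc_self ht)
  have key : ∀ z ∈ Icc u v, derivWithin f (Icc 0 1) z = m := fun z hz =>
    (hm z hz (hC z hz)).derivWithin (uniqueDiffOn_Icc_zero_one z ⟨h0.trans hz.1, hz.2.trans h1⟩)
  rw [key y hy, key u ⟨le_rfl, huv.le⟩, key v ⟨huv.le, le_rfl⟩]
  ring

/-- On an interval with exactly one corner `p`, the logarithmic slope is the average of those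
at the endpoints, corrected by half the jump at `p`. -/
theorem two_log_eq_of_corner (hf : IsPLMap f) {u v p y τ : ℝ} (h0 : 0 ≤ u) (hup : u < p)
    (hpv : p < v) (h1 : v ≤ 1) (hC : ∀ t ∈ Icc u v, t ∈ cornerSet f → t = p)
    (hy : y ∈ Icc u v) (hyp : y ≠ p) (hr : p < y → τ = 1) (hl : y < p → τ = -1) :
    2 * Real.log |derivWithin f (Icc 0 1) y| =
      Real.log |derivWithin f (Icc 0 1) u| + Real.log |derivWithin f (Icc 0 1) v| +
        τ * (Real.log |derivWithin f (Ici p) p| - Real.log |derivWithin f (Iic p) p|) := by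
  have hU := uniqueDiffOn_Icc_zero_one
  have hC' : ∀ t ∈ Icc u v, t ≠ p → t ∉ cornerSet f := fun t ht hne h => hne (hC t ht h)
  obtain ⟨m, -, -, hmp, hm⟩ := hf.exists_slope h0 hup (hpv.le.trans h1) fun t ht =>
    hC' t ⟨ht.1.le, (ht.2.trans hpv).le⟩ ht.2.ne
  obtain ⟨s, -, hsp, -, hs⟩ := hf.exists_slope (h0.trans hup.le) hpv h1 fun t ht =>
    hC' t ⟨(hup.trans ht.1).le, ht.2.le⟩ ht.1.ne'
  have keyl : ∀ z ∈ Ico u p, derivWithin f (Icc 0 1) z = m := fun z hz =>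
    (hm z ⟨hz.1, hz.2.le⟩ (hC' z ⟨hz.1, (hz.2.trans hpv).le⟩ hz.2.ne)).derivWithin
      (hU z ⟨h0.trans hz.1, (hz.2.trans hpv).le.trans h1⟩)
  have keyr : ∀ z ∈ Ioc p v, derivWithin f (Icc 0 1) z = s := fun z hz =>
    (hs z ⟨hz.1.le, hz.2⟩ (hC' z ⟨(hup.trans hz.1).le, hz.2⟩ hz.1.ne')).derivWithin
      (hU z ⟨h0.trans (hup.trans hz.1).le, hz.2.trans h1⟩)
  rw [keyl u ⟨le_rfl, hup⟩, keyr v ⟨hpv, le_rfl⟩, hmp.derivWithin (uniqueDiffWithinAt_Iic p),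
    hsp.derivWithin (uniqueDiffWithinAt_Ici p)]
  rcases hyp.lt_or_gt with h | h
  · rw [keyl y ⟨hy.1, h⟩, hl h]
    ring
  · rw [keyr y ⟨h, hy.2⟩, hr h]
    ring

end IsPLMap

section CycleUnion

variable {f : ℝ → ℝ} {q : ℕ} {I : ℕ → Set ℝ}

theorem IsCycle.isClosed (hI : IsCycle f q I) {j : ℕ} (hj : j < q) : IsClosed (I j) := by
  obtain ⟨u, v, -, h⟩ := hI.2.1 j hj
  exact h ▸ isClosed_Icc

theorem IsCycle.isClosed_cycleUnion (hI : IsCycle f q I) : IsClosed (cycleUnion q I) :=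
  (finite_Iio q).isClosed_biUnion fun _ hj => hI.isClosed hj

theorem mem_cycleUnion {y : ℝ} : y ∈ cycleUnion q I ↔ ∃ j < q, y ∈ I j := by
  simp [cycleUnion]

theorem IsCycle.mem_interior_cycleUnion_iff (hI : IsCycle f q I) {j : ℕ} (hj : j < q) {y : ℝ}
    (hy : y ∈ I j) : y ∈ interior (cycleUnion q I) ↔ y ∈ interior (I j) := by
  have hcl : IsClosed (⋃ i ∈ Iio q \ {j}, I i) :=
    ((finite_Iio q).subset sdiff_subset).isClosed_biUnion fun i hi => hI.isClosed hi.1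
  have hny : y ∉ ⋃ i ∈ Iio q \ {j}, I i := by
    intro h
    simp only [mem_iUnion] at h
    obtain ⟨i, hi, hyi⟩ := h
    exact (hI.2.2.2.1 i hi.1 j hj hi.2).le_bot ⟨hyi, hy⟩
  rw [mem_interior_iff_mem_nhds, mem_interior_iff_mem_nhds]
  refine ⟨fun h => ?_, fun h => mem_of_superset h fun t ht => mem_cycleUnion.2 ⟨j, hj, ht⟩⟩
  filter_upwards [h, hcl.isOpen_compl.mem_nhds hny] with t ht ht'
  obtain ⟨i, hi, hti⟩ := mem_cycleUnion.1 ht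
  by_cases hij : i = j
  · exact hij ▸ hti
  · exact absurd (mem_biUnion (show i ∈ Iio q \ {j} from ⟨hi, hij⟩) hti) ht'

theorem IsCycle.frontier_cycleUnion (hI : IsCycle f q I) :
    frontier (cycleUnion q I) = ⋃ j ∈ Iio q, frontier (I j) := by
  ext y
  rw [hI.isClosed_cycleUnion.frontier_eq]
  simp only [Set.mem_sdiff, mem_iUnion, mem_Iio, exists_prop, mem_cycleUnion]
  constructor
  · rintro ⟨⟨j, hj, hy⟩, h⟩
    refine ⟨j, hj, ?_⟩
    rw [(hI.isClosed hj).frontier_eq]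
    exact ⟨hy, fun h' => h ((hI.mem_interior_cycleUnion_iff hj hy).2 h')⟩
  · rintro ⟨j, hj, h⟩
    rw [(hI.isClosed hj).frontier_eq] at h
    exact ⟨⟨j, hj, h.1⟩, fun h' => h.2 ((hI.mem_interior_cycleUnion_iff hj h.1).1 h')⟩

theorem IsCycle.finsum_frontier_cycleUnion (hI : IsCycle f q I) (g : ℝ → ℝ) :
    ∑ᶠ y ∈ frontier (cycleUnion q I), g y =
      ∑ j ∈ Finset.range q, ∑ᶠ y ∈ frontier (I j), g y := by
  rw [hI.frontier_cycleUnion, finsum_mem_biUnion]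
  · rw [← finsum_mem_coe_finset, Finset.coe_range]
  · intro i hi j hj hij
    exact (hI.2.2.2.1 i hi j hj hij).mono (hI.isClosed hi).frontier_subset
      (hI.isClosed hj).frontier_subset
  · exact finite_Iio q
  · intro j hj
    obtain ⟨u, v, huv, h⟩ := hI.2.1 j hj
    rw [h, frontier_Icc huv.le]
    exact toFinite _

theorem IsCycle.iterate_mem (hI : IsCycle f q I) {x : ℝ} (hx : x ∈ I 0) {i : ℕ} (hi : i < q) :
    f^[i] x ∈ I i := by
  induction i with
  | zero => exact hx
  | succ i ih =>
    have h := hI.2.2.2.2 i (by omega) (mem_image_of_mem f (ih (by omega)))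
    rwa [Nat.mod_eq_of_lt hi, ← Function.iterate_succ_apply' f] at h

end CycleUnion

/-- **The formula of Claim 5 of Theorem C.** For a cycle `𝓘 = {I 0, …, I (q-1)}` of
`f ∈ PL([0,1])` whose intervals contain at most one corner point each, with all corner
points `c 1, …, c d` in the interior of `∪𝓘`, `c j ∈ I (k j)`,
`B = Σ_{y ∈ ∂(∪𝓘)} log |Df(y)|` and `v j` the jump of `log |Df|` at `c j`:
for `x ∈ I 0` whose first `q` iterates avoid the corners, with signs `σ j = ±1`
according to whether `f^(k j)(x)` lies right or left of `c j`, one has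
`2 log |Df^q(x)| = B + Σ_j σ j · v j`. -/
theorem two_log_deriv_formula (f : ℝ → ℝ) (hf : IsPLMap f)
    (d : ℕ) (c : ℕ → ℝ)
    (hcinj : ∀ i < d, ∀ j < d, c i = c j → i = j)
    (hcrange : cornerSet f = c '' Set.Iio d)
    (q : ℕ) (I : ℕ → Set ℝ) (hI : IsCycle f q I)
    (hC : cornerSet f ⊆ interior (cycleUnion q I))
    (hone : ∀ i < q, Set.Subsingleton (cornerSet f ∩ I i))
    (k : ℕ → ℕ) (hk : ∀ j < d, k j < q ∧ c j ∈ I (k j))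
    (x : ℝ) (hx : x ∈ I 0)
    (hxreg : ∀ i < q, f^[i] x ∉ cornerSet f)
    (σ : ℕ → ℝ)
    (hσ : ∀ j < d, (c j < f^[k j] x → σ j = 1) ∧ (f^[k j] x < c j → σ j = -1)) :
    2 * Real.log (|derivWithin (f^[q]) (Set.Icc 0 1) x|) =
      (∑ᶠ y ∈ frontier (cycleUnion q I), Real.log (|derivWithin f (Set.Icc 0 1) y|)) +
        ∑ j ∈ Finset.range d, σ j *
          (Real.log (|derivWithin f (Set.Ici (c j)) (c j)|) -
            Real.log (|derivWithin f (Set.Iic (c j)) (c j)|)) := by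
  rw [hf.log_abs_derivWithin_iterate (hI.2.2.1 0 hI.1 hx) q hxreg,
    hI.finsum_frontier_cycleUnion, Finset.mul_sum,
    ← Finset.sum_fiberwise_of_maps_to (s := Finset.range d) (t := Finset.range q) (g := k)
      fun j hj => Finset.mem_range.2 (hk j (Finset.mem_range.1 hj)).1,
    ← Finset.sum_add_distrib]
  refine Finset.sum_congr rfl fun i hi => ?_
  have hiq := Finset.mem_range.1 hi
  obtain ⟨u, v, huv, hIi⟩ := hI.2.1 i hiq
  have hsub := hI.2.2.1 i hiq
  rw [hIi, Icc_subset_Icc_iff huv.le] at hsub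
  have hxi : f^[i] x ∈ Icc u v := hIi ▸ hI.iterate_mem hx hiq
  rw [hIi, frontier_Icc huv.le, finsum_mem_pair huv.ne]
  have hmem : ∀ j < d, c j ∈ cornerSet f := fun j hj => hcrange ▸ mem_image_of_mem c hj
  by_cases hj : ∃ j < d, k j = i
  · obtain ⟨j, hjd, rfl⟩ := hj
    have hfib : (Finset.range d).filter (fun j' => k j' = k j) = {j} := by
      ext j'
      simp only [Finset.mem_filter, Finset.mem_range, Finset.mem_singleton]
      refine ⟨fun ⟨hd, he⟩ => ?_, fun h => by subst h; exact ⟨hjd, rfl⟩⟩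
      exact hcinj j' hd j hjd (hone _ hiq ⟨hmem j' hd, he ▸ (hk j' hd).2⟩
        ⟨hmem j hjd, (hk j hjd).2⟩)
    have hint := (hI.mem_interior_cycleUnion_iff hiq (hk j hjd).2).1 (hC (hmem j hjd))
    rw [hIi, interior_Icc] at hint
    rw [hfib, Finset.sum_singleton]
    refine hf.two_log_eq_of_corner hsub.1 hint.1 hint.2 hsub.2 (fun t ht htC => ?_) hxi
      (fun h => hxreg _ hiq (h ▸ hmem j hjd)) (hσ j hjd).1 (hσ j hjd).2
    exact hone _ hiq ⟨htC, hIi ▸ ht⟩ ⟨hmem j hjd, (hk j hjd).2⟩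
  · push Not at hj
    rw [Finset.filter_eq_empty_iff.2 fun j h => hj j (Finset.mem_range.1 h), Finset.sum_empty,
      add_zero]
    refine hf.two_log_eq_of_no_corner hsub.1 huv hsub.2 (fun t ht htC => ?_) hxi
    rw [hcrange] at htC
    obtain ⟨j, hjd, rfl⟩ := htC
    refine hj j hjd (by_contra fun hne => ?_)
    exact (hI.2.2.2.1 _ (hk j hjd).1 i hiq hne).le_bot ⟨(hk j hjd).2, hIi ▸ ht⟩
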